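/- Let G be a finite group, S a set of subgroups closed under conjugation, and F_S the fusion category with object set S and morphisms the group homomorphisms H → K induced by conjugation by elements of G. Then F_S has skeletal Möbius inversion, and its skeletal coweighting is t(K) = −μ_{S₋}(−∞, K)/[G : C_G(K)], where S₋ is S with an added minimum element −∞. -/

import Mathlib

open scoped Classical

/-- The reduced Euler characteristic of (the order complex of) a poset `P`.
For a poset `P₋` obtained from `P` by adding a minimum `−∞`, one has
`−μ_{P₋}(−∞, K) = −χ̃(P_{<K})` for `K ∈ P`. -/
noncomputable def reducedEuler (P : Type*) [Preorder P] : ℚ :=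
  -1 + ∑ᶠ d : ℕ, (-1 : ℚ) ^ d * (Nat.card { f : Fin (d + 1) → P // StrictMono f } : ℚ)

/-- The conjugate subgroup `gHg⁻¹`. -/
def conjSub {G : Type*} [Group G] (H : Subgroup G) (g : G) : Subgroup G :=
  H.map (MulAut.conj g).toMonoidHom

/-- The hom-set `F_S(H,K)` of the fusion category: group homomorphisms
`H → K` induced by conjugation by an element of `G`. -/
def FusionHom {G : Type*} [Group G] (H K : Subgroup G) : Type _ :=
  { f : H →* K // ∃ g : G, ∀ x : H, (f x : G) = g * x * g⁻¹ }

section ReducedEuler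

lemma natCard_strictMono_fin_succ (P : Type*) [PartialOrder P] [Fintype P] (d : ℕ) :
    Nat.card { f : Fin (d + 1) → P // StrictMono f } =
      ∑ x : P, Nat.card { f : Fin d → { y : P // y < x } // StrictMono f } := by
  have hext (p q : Σ x : P, { f : Fin d → { y : P // y < x } // StrictMono f })
      (h : p.1 = q.1) (h' : ∀ i, (p.2.1 i : P) = q.2.1 i) : p = q := by
    obtain ⟨x, f⟩ := p
    obtain ⟨y, f'⟩ := q
    obtain rfl : x = y := h
    congr 1
    ext i
    exact h' i
  rw [← Nat.card_sigma]
  refine Nat.card_congr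
    { toFun := fun f => ⟨f.1 (Fin.last d),
        fun i => ⟨f.1 i.castSucc, f.2 (Fin.castSucc_lt_last i)⟩,
        fun i j hij => f.2 (Fin.castSucc_lt_castSucc_iff.2 hij)⟩
      invFun := fun p => ⟨Fin.snoc (α := fun _ => P) (fun i => (p.2.1 i : P)) p.1, ?_⟩
      left_inv := ?_
      right_inv := ?_ }
  · intro i j hij
    induction j using Fin.lastCases with
    | last =>
      induction i using Fin.lastCases with
      | last => exact absurd hij (lt_irrefl _)
      | cast i => simpa using (p.2.1 i).2
    | cast j =>
      induction i using Fin.lastCases with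
      | last => exact absurd hij (not_lt.2 (Fin.le_last _))
      | cast i => simpa using p.2.2 (Fin.castSucc_lt_castSucc_iff.1 hij)
  · rintro ⟨f, hf⟩
    ext i
    induction i using Fin.lastCases <;> simp
  · rintro ⟨x, f, hf⟩
    exact hext _ _ (by simp) (by simp)

lemma reducedEuler_eq_sum_range (P : Type*) [Preorder P] [Fintype P] {N : ℕ}
    (hN : Fintype.card P ≤ N) :
    reducedEuler P = -1 + ∑ d ∈ Finset.range N,
      (-1 : ℚ) ^ d * (Nat.card { f : Fin (d + 1) → P // StrictMono f } : ℚ) := by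
  rw [reducedEuler, finsum_eq_sum_of_support_subset]
  intro d hd
  by_contra hdN
  have : IsEmpty { f : Fin (d + 1) → P // StrictMono f } := by
    refine ⟨fun f => ?_⟩
    have := Fintype.card_le_of_injective f.1 f.2.injective
    simp at this hdN
    omega
  exact hd (by simp)

lemma reducedEuler_eq_neg_sum_range (P : Type*) [Preorder P] [Fintype P] {N : ℕ}
    (hN : Fintype.card P ≤ N) :
    reducedEuler P = -∑ d ∈ Finset.range (N + 1),
      (-1 : ℚ) ^ d * (Nat.card { f : Fin d → P // StrictMono f } : ℚ) := by
  have h0 : Nat.card { f : Fin 0 → P // StrictMono f } = 1 := by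
    rw [Nat.card_eq_one_iff_unique]
    exact ⟨inferInstance, ⟨⟨Fin.elim0, fun i => i.elim0⟩⟩⟩
  rw [Finset.sum_range_succ', h0, reducedEuler_eq_sum_range P hN]
  simp only [pow_succ, mul_neg, mul_one, neg_mul, Finset.sum_neg_distrib]
  simp

lemma reducedEuler_congr {P Q : Type*} [Preorder P] [Preorder Q] (e : P ≃o Q) :
    reducedEuler P = reducedEuler Q := by
  unfold reducedEuler
  congr 1
  refine finsum_congr fun d => ?_
  congr 2
  exact Nat.card_congr ((Equiv.arrowCongr (Equiv.refl _) e.toEquiv).subtypeEquiv fun f =>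
    ⟨fun h => e.strictMono.comp h, fun h i j hij => e.lt_iff_lt.1 (h hij)⟩)

lemma sum_reducedEuler_Iio (P : Type*) [PartialOrder P] [Fintype P] :
    ∑ x : P, reducedEuler { y : P // y < x } = -(reducedEuler P + 1) := by
  have h (x : P) := reducedEuler_eq_neg_sum_range { y : P // y < x }
    (Fintype.card_subtype_le (fun y => y < x))
  rw [Finset.sum_congr rfl fun x _ => h x, Finset.sum_neg_distrib, Finset.sum_comm,
    reducedEuler_eq_sum_range P (Nat.le_succ (Fintype.card P))]
  simp only [← Finset.mul_sum, ← Nat.cast_sum, ← natCard_strictMono_fin_succ]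
  simp

lemma sum_reducedEuler_Iic {P : Type*} [PartialOrder P] [Fintype P] (K : P) :
    ∑ x : P, (if x ≤ K then reducedEuler { y : P // y < x } else 0) = -1 := by
  have h := sum_reducedEuler_Iio { x : P // x < K }
  have hx (x : { x : P // x < K }) :
      reducedEuler { y : { x : P // x < K } // y < x } = reducedEuler { y : P // y < x.1 } :=
    reducedEuler_congr
      { toFun := fun y => ⟨y.1.1, y.2⟩
        invFun := fun y => ⟨⟨y.1, y.2.trans x.2⟩, y.2⟩
        left_inv := fun _ => rfl
        right_inv := fun _ => rfl
        map_rel_iff' := Iff.rfl }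
  simp only [hx] at h
  rw [← Finset.sum_subtype (Finset.univ.filter (· < K)) (by simp)
    (fun x => reducedEuler { y : P // y < x }), Finset.sum_filter] at h
  have hsplit (x : P) : (if x ≤ K then reducedEuler { y : P // y < x } else 0) =
      (if x < K then reducedEuler { y : P // y < x } else 0) +
        if x = K then reducedEuler { y : P // y < x } else 0 := by
    rcases eq_or_ne x K with rfl | hne
    · simp
    · simp [hne, le_iff_lt_or_eq]
  rw [Finset.sum_congr rfl fun x _ => hsplit x, Finset.sum_add_distrib, h]
  simp

end ReducedEuler

section OrbitAverage

open Matrix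

variable (G : Type*) {X : Type*} [Group G] [Fintype G] [MulAction G X]

/-- The matrix of the operator averaging a function over the orbits of `G`. -/
noncomputable def orbitAverage (X : Type*) [MulAction G X] : Matrix X X ℚ :=
  of fun x y => (∑ g : G, if g • x = y then 1 else 0) / (Fintype.card G : ℚ)

lemma orbitAverage_apply (x y : X) : orbitAverage G X x y =
    if ∃ g : G, g • x = y then 1 / (Nat.card { z : X // ∃ g : G, g • x = z } : ℚ) else 0 := by
  split_ifs with h
  · obtain ⟨a, rfl⟩ := h
    have hsum : (∑ g : G, if g • x = a • x then (1 : ℚ) else 0) =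
        Nat.card (MulAction.stabilizer G x) := by
      rw [← Equiv.sum_comp (Equiv.mulLeft a)]
      simp [mul_smul, Nat.card_eq_fintype_card, Fintype.card_subtype]
    have horb : Nat.card { z : X // ∃ g : G, g • x = z } * Nat.card (MulAction.stabilizer G x) =
        Fintype.card G := by
      rw [← Nat.card_eq_fintype_card, ← (MulAction.stabilizer G x).index_mul_card,
        MulAction.index_stabilizer]
      rfl
    have hpos : (Nat.card (MulAction.stabilizer G x) : ℚ) ≠ 0 := by
      exact_mod_cast Nat.card_pos.ne'
    rw [orbitAverage, of_apply, hsum, ← horb, Nat.cast_mul, div_mul_cancel_right₀ hpos, one_div]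
  · push Not at h
    simp [orbitAverage, h]

lemma orbitAverage_comm (x y : X) : orbitAverage G X x y = orbitAverage G X y x := by
  simp only [orbitAverage, of_apply]
  rw [← Equiv.sum_comp (Equiv.inv G)]
  simp only [Equiv.inv_apply, inv_smul_eq_iff, eq_comm (a := x)]

lemma orbitAverage_smul_left (g : G) (x y : X) :
    orbitAverage G X (g • x) y = orbitAverage G X x y := by
  simp only [orbitAverage, of_apply]
  rw [← Equiv.sum_comp (Equiv.mulRight g⁻¹)]
  simp [mul_smul]

variable [Fintype X]

lemma sum_orbitAverage_mul (f : X → ℚ) (x : X) :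
    ∑ y, orbitAverage G X x y * f y = (∑ g : G, f (g • x)) / (Fintype.card G : ℚ) := by
  simp only [orbitAverage, of_apply, div_mul_eq_mul_div, ← Finset.sum_div, Finset.sum_mul]
  rw [Finset.sum_comm]
  simp

lemma sum_orbitAverage_mul_of_invariant {f : X → ℚ} (hf : ∀ (g : G) x, f (g • x) = f x) (x : X) :
    ∑ y, orbitAverage G X x y * f y = f x := by
  simp [sum_orbitAverage_mul, hf]

lemma vecMul_orbitAverage_of_invariant {f : X → ℚ} (hf : ∀ (g : G) x, f (g • x) = f x) :
    f ᵥ* orbitAverage G X = f := by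
  ext x
  rw [← sum_orbitAverage_mul_of_invariant G hf x]
  simp only [vecMul, dotProduct]
  exact Finset.sum_congr rfl fun y _ => by rw [orbitAverage_comm, mul_comm]

lemma orbitAverage_mul_self : orbitAverage G X * orbitAverage G X = orbitAverage G X := by
  ext x y
  exact sum_orbitAverage_mul_of_invariant G (fun g z => orbitAverage_smul_left G g z y) x

lemma orbitAverage_mul_comm {A : Matrix X X ℚ} (hA : ∀ (g : G) x y, A (g • x) (g • y) = A x y) :
    orbitAverage G X * A = A * orbitAverage G X := by
  ext x y
  rw [mul_apply, mul_apply, sum_orbitAverage_mul G (fun z => A z y)]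
  have : ∑ z, A x z * orbitAverage G X z y = ∑ z, orbitAverage G X y z * A x z :=
    Finset.sum_congr rfl fun z _ => by rw [orbitAverage_comm, mul_comm]
  rw [this, sum_orbitAverage_mul, ← Equiv.sum_comp (Equiv.inv G)]
  congr 1
  refine Finset.sum_congr rfl fun g _ => ?_
  rw [← hA g]
  simp

end OrbitAverage

section Inversion

open Matrix

lemma exists_inverse_zetaMatrix (X : Type*) [Fintype X] [PartialOrder X] :
    ∃ W : Matrix X X ℚ, (of fun x y : X => if x ≤ y then (1 : ℚ) else 0) * W = 1 ∧
      W * (of fun x y : X => if x ≤ y then (1 : ℚ) else 0) = 1 := by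
  let _ : LocallyFiniteOrder X := Fintype.toLocallyFiniteOrder
  have key : (of fun x y : X => if x ≤ y then (1 : ℚ) else 0) *
      (of fun x y : X => IncidenceAlgebra.mu ℚ x y) = 1 := by
    ext x y
    have h := congrArg (fun f : IncidenceAlgebra ℚ X => f x y)
      (IncidenceAlgebra.zeta_mul_mu (𝕜 := ℚ) (α := X))
    simp only [IncidenceAlgebra.mul_apply, IncidenceAlgebra.one_apply] at h
    rw [mul_apply, one_apply, ← h]
    symm
    refine Finset.sum_subset (Finset.subset_univ _) fun z _ hz => ?_
    rw [Finset.mem_Icc, not_and_or] at hz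
    rcases hz with hz | hz
    · simp [hz]
    · simp [IncidenceAlgebra.apply_eq_zero_of_not_le hz]
  exact ⟨_, key, mul_eq_one_comm.1 key⟩

variable {G X : Type*} [Group G] [Fintype G] [Fintype X] [PartialOrder X] [MulAction G X]

/-- A matrix whose `(x, y)` entry is an invariant weight of `x` times the number of `g` with
`g • x ≤ y` is invertible in the corner algebra of the orbit average. -/
lemma exists_skeletal_inverse (hle : ∀ (g : G) (x y : X), g • x ≤ g • y ↔ x ≤ y)
    {d : X → ℚ} (hd : ∀ x, d x ≠ 0) (hdG : ∀ (g : G) x, d (g • x) = d x)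
    {z : Matrix X X ℚ}
    (hz : ∀ x y, z x y = d x * ∑ g : G, if g • x ≤ y then (1 : ℚ) else 0) :
    ∃ ν : Matrix X X ℚ,
      orbitAverage G X * ν * orbitAverage G X = ν ∧
      z * ν = orbitAverage G X ∧ ν * z = orbitAverage G X := by
  obtain ⟨W, hZW, hWZ⟩ := exists_inverse_zetaMatrix X
  set Z : Matrix X X ℚ := of fun x y => if x ≤ y then (1 : ℚ) else 0
  set e := orbitAverage G X
  have hcard : (Fintype.card G : ℚ) ≠ 0 := by exact_mod_cast Fintype.card_ne_zero
  let D := diagonal fun x => (Fintype.card G : ℚ) * d x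
  let D' := diagonal fun x => ((Fintype.card G : ℚ) * d x)⁻¹
  have hDD' : D * D' = 1 := by
    simp only [D, D', diagonal_mul_diagonal, mul_inv_cancel₀ (mul_ne_zero hcard (hd _)),
      diagonal_one]
  have hD'D : D' * D = 1 := mul_eq_one_comm.1 hDD'
  have hee : e * e = e := orbitAverage_mul_self G
  have heZ : e * Z = Z * e := orbitAverage_mul_comm G fun g x y => by simp [Z, hle]
  have heW : e * W = W * e := by
    calc e * W = W * Z * (e * W) := by rw [hWZ, one_mul]
      _ = W * (Z * e) * W := by simp only [mul_assoc]
      _ = W * e * (Z * W) := by rw [← heZ]; simp only [mul_assoc]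
      _ = W * e := by rw [hZW, mul_one]
  have heD' : e * D' = D' * e := orbitAverage_mul_comm G fun g x y => by
    simp [D', diagonal_apply, hdG]
  have hzD : z = D * (e * Z) := by
    ext x y
    rw [hz, diagonal_mul, mul_apply, sum_orbitAverage_mul G (fun w => Z w y)]
    simp only [Z, of_apply]
    field_simp
  refine ⟨W * (e * D'), ?_, ?_, ?_⟩
  · calc e * (W * (e * D')) * e = (e * W) * (e * (D' * e)) := by simp only [mul_assoc]
      _ = W * (e * e * e * D') := by rw [heW, ← heD']; simp only [mul_assoc]
      _ = W * (e * D') := by rw [hee, hee]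
  · calc z * (W * (e * D')) = D * (e * (Z * W) * (e * D')) := by
          rw [hzD]; simp only [mul_assoc]
      _ = D * (e * e * D') := by rw [hZW, mul_one, mul_assoc]
      _ = D * D' * e := by rw [hee, heD', mul_assoc]
      _ = e := by rw [hDD', one_mul]
  · calc W * (e * D') * z = W * (e * (D' * D) * e * Z) := by
          rw [hzD]; simp only [mul_assoc]
      _ = W * Z * e := by rw [hD'D, mul_one, hee, heZ, mul_assoc]
      _ = e := by rw [hWZ, one_mul]

end Inversion

section Fusion

variable {G : Type*} [Group G]

lemma mem_conjSub {H : Subgroup G} {g x : G} : x ∈ conjSub H g ↔ g⁻¹ * x * g ∈ H := by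
  unfold conjSub
  constructor
  · rintro ⟨y, hy, rfl⟩
    simpa [mul_assoc] using hy
  · exact fun h => ⟨_, h, by simp [mul_assoc]⟩

lemma conjSub_le_iff {H K : Subgroup G} {g : G} :
    conjSub H g ≤ K ↔ ∀ x ∈ H, g * x * g⁻¹ ∈ K := by
  simp [conjSub, SetLike.le_def]

lemma conjSub_one (H : Subgroup G) : conjSub H 1 = H := by
  ext; simp [mem_conjSub]

lemma conjSub_mul (H : Subgroup G) (a b : G) : conjSub H (a * b) = conjSub (conjSub H b) a := by
  ext; simp [mem_conjSub, mul_assoc]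

/-- Conjugation by `g` as an automorphism of the lattice of subgroups. -/
def conjSubOrderIso (g : G) : Subgroup G ≃o Subgroup G :=
  (MulAut.conj g).mapSubgroup

lemma centralizer_conjSub (H : Subgroup G) (g : G) :
    Subgroup.centralizer (conjSub H g : Set G) = conjSub (Subgroup.centralizer (H : Set G)) g := by
  ext x
  simp only [mem_conjSub, Subgroup.mem_centralizer_iff, SetLike.mem_coe]
  constructor
  · intro h y hy
    have := h (g * y * g⁻¹) (by simpa [mul_assoc] using hy)
    simpa [mul_assoc] using congrArg (fun w => g⁻¹ * w * g) this
  · intro h y hy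
    have := h _ hy
    simpa [mul_assoc] using congrArg (fun w => g * w * g⁻¹) this

lemma natCard_conjSub (H : Subgroup G) (g : G) : Nat.card (conjSub H g) = Nat.card H :=
  Subgroup.card_map_of_injective (MulAut.conj g).injective

lemma natCard_fusionHom_mul_natCard_centralizer (H K : Subgroup G) :
    Nat.card (FusionHom H K) * Nat.card (Subgroup.centralizer (H : Set G)) =
      Nat.card { g : G // conjSub H g ≤ K } := by
  rw [← Nat.card_prod]
  have hspec (f : FusionHom H K) := f.2.choose_spec
  have hconj (c : Subgroup.centralizer (H : Set G)) (x : H) : (c : G) * x * (c : G)⁻¹ = x := by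
    rw [← Subgroup.mem_centralizer_iff.1 c.2 x x.2, mul_inv_cancel_right]
  have hmul (f : FusionHom H K) (c : Subgroup.centralizer (H : Set G)) (x : H) :
      f.2.choose * c * x * (f.2.choose * c)⁻¹ = (f.1 x : G) := by
    rw [hspec f x]
    nth_rewrite 2 [← hconj c x]
    group
  refine Nat.card_congr (Equiv.ofBijective
    (fun p => ⟨p.1.2.choose * p.2, conjSub_le_iff.2 fun x hx => ?_⟩) ⟨?_, ?_⟩)
  · rw [hmul p.1 p.2 ⟨x, hx⟩]
    exact (p.1.1 _).2
  · rintro ⟨f, c⟩ ⟨f', c'⟩ h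
    have h : f.2.choose * (c : G) = f'.2.choose * (c' : G) := congrArg Subtype.val h
    obtain rfl : f = f' := by
      refine Subtype.ext (MonoidHom.ext fun x => Subtype.ext ?_)
      rw [← hmul f c, ← hmul f' c', h]
    rw [mul_right_inj] at h
    rw [Subtype.ext h]
  · rintro ⟨g, hg⟩
    let f : FusionHom H K :=
      ⟨((MulAut.conj g).toMonoidHom.comp H.subtype).codRestrict K
        fun x => conjSub_le_iff.1 hg x x.2, g, fun x => by simp⟩
    have hf (x : H) : g * x * g⁻¹ = f.2.choose * x * f.2.choose⁻¹ := by
      rw [← hspec f x]; simp [f]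
    refine ⟨(f, ⟨f.2.choose⁻¹ * g, Subgroup.mem_centralizer_iff.2 fun x hx => ?_⟩), ?_⟩
    · have := hf ⟨x, hx⟩
      simp only at this
      have := congrArg (fun w => f.2.choose⁻¹ * w * g) this
      simpa [mul_assoc] using this.symm
    · simp

lemma natCard_fusionHom [Fintype G] (H K : Subgroup G) :
    (Nat.card (FusionHom H K) : ℚ) =
      (Nat.card (Subgroup.centralizer (H : Set G)) : ℚ)⁻¹ *
        ∑ g : G, if conjSub H g ≤ K then 1 else 0 := by
  have h : (Nat.card (Subgroup.centralizer (H : Set G)) : ℚ) ≠ 0 := by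
    exact_mod_cast Nat.card_pos.ne'
  rw [eq_inv_mul_iff_mul_eq₀ h, mul_comm]
  exact_mod_cast (natCard_fusionHom_mul_natCard_centralizer H K).trans
    (by simp [Nat.card_eq_fintype_card, Fintype.card_subtype])

lemma reducedEuler_conjSub {S : Set (Subgroup G)} (hconj : ∀ H ∈ S, ∀ g : G, conjSub H g ∈ S)
    (K : Subgroup G) (g : G) :
    reducedEuler { L : Subgroup G // L ∈ S ∧ L < conjSub K g } =
      reducedEuler { L : Subgroup G // L ∈ S ∧ L < K } := by
  have hmem (L : Subgroup G) : L ∈ S ↔ conjSub L g ∈ S := by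
    refine ⟨fun h => hconj L h g, fun h => ?_⟩
    simpa [← conjSub_mul, conjSub_one] using hconj _ h g⁻¹
  symm
  exact reducedEuler_congr
    { toEquiv := (conjSubOrderIso g).toEquiv.subtypeEquiv fun L =>
        and_congr (hmem L) (conjSubOrderIso g).lt_iff_lt.symm
      map_rel_iff' := (conjSubOrderIso g).le_iff_le }

/-- The conjugation action of `G` on a conjugation-closed set of subgroups. -/
abbrev conjSubAction {S : Set (Subgroup G)} (hconj : ∀ H ∈ S, ∀ g : G, conjSub H g ∈ S) :
    MulAction G S where
  smul g H := ⟨conjSub H g, hconj H H.2 g⟩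
  one_smul H := Subtype.ext (conjSub_one H.1)
  mul_smul a b H := Subtype.ext (conjSub_mul H.1 a b)

end Fusion

/-- let `S` be a conjugation-closed set of subgroups of a finite
group `G` and `F_S` the fusion category on `S`.  Then `F_S` has skeletal
Möbius inversion, and its skeletal coweighting (the unique coweighting
constant on isomorphism classes, i.e. on conjugacy classes) is
`t(K) = −χ̃(S_{<K}) / [G : C_G(K)]  ( = −μ_{S₋}(−∞,K) / [G : C_G(K)] )`. -/
theorem fusion_category_skeletal_coweighting {G : Type*} [Group G] [Fintype G]
    (S : Set (Subgroup G))
    (hconj : ∀ H ∈ S, ∀ g : G, conjSub H g ∈ S)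
    (t : Subgroup G → ℚ)
    (ht : ∀ K : Subgroup G,
      t K = - reducedEuler { L : Subgroup G // L ∈ S ∧ L < K } /
        ((Subgroup.centralizer (K : Set G)).index : ℚ)) :
    -- `F_S` has skeletal Möbius inversion: `ζ` is invertible in the corner
    -- algebra on the idempotent `e` of isomorphism (= conjugacy) classes
    (∃ ν : S → S → ℚ,
      (let e : S → S → ℚ := fun H K =>
        if ∃ g : G, conjSub (H : Subgroup G) g = (K : Subgroup G) then
          1 / (Nat.card { L : S // ∃ g : G,
            conjSub (H : Subgroup G) g = (L : Subgroup G) } : ℚ)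
        else 0
       let zeta : S → S → ℚ := fun H K =>
        (Nat.card (FusionHom (H : Subgroup G) (K : Subgroup G)) : ℚ)
       (∀ H K : S, ∑ᶠ L : S, ∑ᶠ M : S, e H L * ν L M * e M K = ν H K) ∧
       (∀ H K : S, ∑ᶠ L : S, zeta H L * ν L K = e H K) ∧
       (∀ H K : S, ∑ᶠ L : S, ν H L * zeta L K = e H K))) ∧
    -- `t` is a coweighting on `F_S`
    (∀ K ∈ S, ∑ᶠ H : S,
        t H * (Nat.card (FusionHom (H : Subgroup G) K) : ℚ) = 1) ∧
    -- `t` is constant on conjugacy classes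
    (∀ K ∈ S, ∀ g : G, t (conjSub K g) = t K) ∧
    -- and it is the unique such coweighting
    (∀ t' : Subgroup G → ℚ,
      (∀ K ∈ S, ∑ᶠ H : S,
          t' H * (Nat.card (FusionHom (H : Subgroup G) K) : ℚ) = 1) →
      (∀ K ∈ S, ∀ g : G, t' (conjSub K g) = t' K) →
      ∀ K ∈ S, t' K = t K) := by
  let _ : MulAction G S := conjSubAction hconj
  let _ : Fintype S := Fintype.ofFinite S
  have hsmul (g : G) (H K : S) : g • H = K ↔ conjSub H g = (K : Subgroup G) := Subtype.ext_iff
  have hle (g : G) (H K : S) : g • H ≤ g • K ↔ H ≤ K := (conjSubOrderIso g).le_iff_le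
  have he (H K : S) := orbitAverage_apply G H K
  simp only [hsmul] at he
  have hcent (H : Subgroup G) (g : G) :
      Nat.card (Subgroup.centralizer (conjSub H g : Set G)) =
        Nat.card (Subgroup.centralizer (H : Set G)) := by
    rw [centralizer_conjSub, natCard_conjSub]
  have hcent0 (H : Subgroup G) : (Nat.card (Subgroup.centralizer (H : Set G)) : ℚ) ≠ 0 := by
    exact_mod_cast Nat.card_pos.ne'
  have hindex (H : Subgroup G) : ((Subgroup.centralizer (H : Set G)).index : ℚ) =
      (Fintype.card G : ℚ) / Nat.card (Subgroup.centralizer (H : Set G)) := by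
    rw [eq_div_iff (hcent0 H), ← Nat.card_eq_fintype_card]
    exact_mod_cast Subgroup.index_mul_card _
  have hcard : (Fintype.card G : ℚ) ≠ 0 := by exact_mod_cast Fintype.card_ne_zero
  let zeta : Matrix S S ℚ := fun H K => (Nat.card (FusionHom (H : Subgroup G) K) : ℚ)
  obtain ⟨ν, hν, hzν, hνz⟩ := exists_skeletal_inverse (G := G) hle
    (d := fun H : S => (Nat.card (Subgroup.centralizer ((H : Subgroup G) : Set G)) : ℚ)⁻¹)
    (z := zeta) (fun H => inv_ne_zero (hcent0 H))
    (fun g H => congrArg (fun n : ℕ => (n : ℚ)⁻¹) (hcent H g))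
    (fun H K => natCard_fusionHom (H : Subgroup G) (K : Subgroup G))
  have htconj (K : Subgroup G) (g : G) : t (conjSub K g) = t K := by
    rw [ht, ht, hindex, hindex, reducedEuler_conjSub hconj, hcent]
  have hEuler (H : S) : reducedEuler { L : S // L < H } =
      reducedEuler { L : Subgroup G // L ∈ S ∧ L < H } :=
    reducedEuler_congr
      { toFun := fun L => ⟨L.1, L.1.2, L.2⟩
        invFun := fun L => ⟨⟨L.1, L.2.1⟩, L.2.2⟩
        left_inv := fun _ => rfl
        right_inv := fun _ => rfl
        map_rel_iff' := Iff.rfl }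
  have htcow (K : S) : ∑ H : S, t H * zeta H K = 1 := by
    have hterm (H : S) : t H * zeta H K =
        -(Fintype.card G : ℚ)⁻¹ * ∑ g : G,
          if g • H ≤ K then reducedEuler { L : S // L < g • H } else 0 := by
      have hinv (g : G) : reducedEuler { L : S // L < g • H } =
          reducedEuler { L : Subgroup G // L ∈ S ∧ L < H } :=
        (hEuler _).trans (reducedEuler_conjSub hconj H g)
      have hz : zeta H K = _ := natCard_fusionHom (H : Subgroup G) (K : Subgroup G)
      have hiff (g : G) : g • H ≤ K ↔ conjSub H g ≤ (K : Subgroup G) := Iff.rfl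
      have h0 := hcent0 H
      rw [ht, hindex, hz]
      simp only [hinv, hiff, ← mul_boole _ (reducedEuler _), ← Finset.mul_sum]
      field_simp
    have hg (g : G) : ∑ H : S, (if g • H ≤ K then reducedEuler { L : S // L < g • H } else 0) =
        -1 := by
      rw [← sum_reducedEuler_Iic K]
      exact Equiv.sum_comp (MulAction.toPerm g)
        (fun H : S => if H ≤ K then reducedEuler { L : S // L < H } else 0)
    rw [Finset.sum_congr rfl fun H _ => hterm H, ← Finset.mul_sum, Finset.sum_comm]
    simp [hg, hcard]
  simp only [finsum_eq_sum_of_fintype]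
  refine ⟨⟨ν, fun H K => ?_, fun H K => ?_, fun H K => ?_⟩, fun K hK => htcow ⟨K, hK⟩,
    fun K _ g => htconj K g, fun t' ht' ht'conj K hK => ?_⟩
  · simp only [← he]
    rw [← congrFun₂ hν H K, Matrix.mul_apply, Finset.sum_comm]
    simp only [Matrix.mul_apply, Finset.sum_mul]
  · rw [← he, ← hzν, Matrix.mul_apply]
  · rw [← he, ← hνz, Matrix.mul_apply]
  · have key (u : Subgroup G → ℚ) (hu : ∀ K : S, ∑ H : S, u H * zeta H K = 1)
        (hu' : ∀ K ∈ S, ∀ g : G, u (conjSub K g) = u K) :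
        (fun H : S => u H) = Matrix.vecMul (fun _ => 1) ν := by
      rw [← vecMul_orbitAverage_of_invariant G (f := fun H : S => u H)
        (fun g H => hu' H H.2 g), ← hzν, ← Matrix.vecMul_vecMul]
      congr 1
      ext K
      exact hu K
    exact congrFun ((key t' (fun K => ht' K K.2) ht'conj).trans
      (key t htcow fun K _ g => htconj K g).symm) ⟨K, hK⟩
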